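/- arXiv:2207.04485 — 2 statements merged into one kernel-verified Lean document; each statement's English description precedes it below -/
import Mathlib

section
/- Let σ > 0, ε₀ > 0 and δ ∈ ℝ. There exists a constant C = C(ε₀, δ, σ) > 0 such that for every s ≤ 0 and every Schwartz function u : ℝ → ℂ whose Fourier transform is supported in [ε₀, ∞), the gauge transform 𝒢(u) := u · exp(−δ·∂ₓ⁻¹(u u*)) satisfies ‖𝒢(u)‖_{E^s_σ} ≤ exp(C ‖u‖²_{E^s_σ}) · ‖u‖_{E^s_σ}. -/
open MeasureTheory Real FourierTransform

/-- The `E^s_σ` norm of `f : ℝ → ℂ`: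
`‖f‖_{E^s_σ} = (∫ ⟨ξ⟩^{2σ} 2^{2s|ξ|} |𝓕f(ξ)|² dξ)^{1/2}`, with `⟨ξ⟩^{2σ} = (1+ξ²)^σ`. -/
noncomputable def Enorm (s σ : ℝ) (f : ℝ → ℂ) : ℝ :=
  (∫ ξ : ℝ, (1 + ξ ^ 2) ^ σ * (2 : ℝ) ^ (2 * s * |ξ|) * ‖𝓕 f ξ‖ ^ 2) ^ (1 / 2 : ℝ)

/-- The antiderivative `∂ₓ⁻¹ f (x) = ½(∫_{-∞}^x f − ∫_x^∞ f)`. -/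
noncomputable def pinv (f : ℝ → ℂ) (x : ℝ) : ℂ :=
  (1 / 2 : ℂ) * ((∫ y in Set.Iic x, f y) - ∫ y in Set.Ici x, f y)

/-- The gauge transform `𝒢(u) = u · exp(−δ ∂ₓ⁻¹(u u*))`, where `u*(x) = conj(u(−x))`. -/
noncomputable def gaugeT (δ : ℝ) (u : ℝ → ℂ) (x : ℝ) : ℂ :=
  u x * Complex.exp (-(δ : ℂ) * pinv (fun y => u y * (starRingEnd ℂ) (u (-y))) x)

open Filter Topology

/-- Multiplication by an inverse Fourier transform becomes convolution on the Fourier side. -/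
theorem fourier_mul_fourierInv {f G : ℝ → ℂ} (hf : Integrable f) (hG : Integrable G) (ξ : ℝ) :
    𝓕 (fun x => f x * 𝓕⁻ G x) ξ = ∫ η, G η * 𝓕 f (ξ - η) := by
  have hint : Integrable (fun p : ℝ × ℝ => 𝐞 (-(p.1 * ξ)) • (f p.1 * (𝐞 (p.2 * p.1) • G p.2)))
      (volume.prod volume) := by
    refine (hf.mul_prod hG).mono ?_ (by simp)
    have h1 := (hf.mul_prod hG).aestronglyMeasurable
    have h2 : Continuous (fun p : ℝ × ℝ => (𝐞 (-(p.1 * ξ)) : ℂ) * (𝐞 (p.2 * p.1) : ℂ)) := by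
      fun_prop
    refine (h2.aestronglyMeasurable.mul h1).congr (Eventually.of_forall fun p => ?_)
    simp [Circle.smul_def]; ring
  simp only [Real.fourier_real_eq, Real.fourierInv_eq, RCLike.inner_apply, conj_trivial]
  simp_rw [← integral_const_mul]
  calc ∫ x, 𝐞 (-(x * ξ)) • ∫ η, f x * (𝐞 (x * η) • G η)
      = ∫ x, ∫ η, 𝐞 (-(x * ξ)) • (f x * (𝐞 (η * x) • G η)) := by
        congr 1; ext x; simp only [Circle.smul_def]
        rw [← integral_smul]
        simp_rw [mul_comm x]
    _ = ∫ η, ∫ x, 𝐞 (-(x * ξ)) • (f x * (𝐞 (η * x) • G η)) :=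
        integral_integral_swap hint
    _ = _ := by
        congr 1; ext η
        congr 1; ext x
        have : (𝐞 (-(x * (ξ - η))) : ℂ) = 𝐞 (-(x * ξ)) * 𝐞 (η * x) := by
          rw [← Circle.coe_mul, ← AddChar.map_add_eq_mul]; congr 2; ring
        simp only [Circle.smul_def, smul_eq_mul, this]; ring

/-- Pointwise domination by a convolution. -/
theorem enorm_fourier_mul_fourierInv_le {f G : ℝ → ℂ} (hf : Integrable f) (hG : Integrable G)
    (ξ : ℝ) : ‖𝓕 (fun x => f x * 𝓕⁻ G x) ξ‖ₑ ≤ ∫⁻ η, ‖G η‖ₑ * ‖𝓕 f (ξ - η)‖ₑ := by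
  rw [fourier_mul_fourierInv hf hG]
  simpa using enorm_integral_le_lintegral_enorm (fun η => G η * 𝓕 f (ξ - η))

theorem continuous_fourier_of_integrable {f : ℝ → ℂ} (hf : Integrable f) : Continuous (𝓕 f) :=
  VectorFourier.fourierIntegral_continuous Real.continuous_fourierChar
    (by exact continuous_inner) hf

theorem continuous_fourierInv_of_integrable {f : ℝ → ℂ} (hf : Integrable f) :
    Continuous (𝓕⁻ f) := by
  rw [show 𝓕⁻ f = fun x => 𝓕 f (-x) from funext fun x => Real.fourierInv_eq_fourier_neg f x]
  exact (continuous_fourier_of_integrable hf).comp continuous_neg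

theorem norm_fourierInv_le {f : ℝ → ℂ} (x : ℝ) : ‖𝓕⁻ f x‖ ≤ ∫ ξ, ‖f ξ‖ := by
  rw [Real.fourierInv_eq]
  refine (norm_integral_le_integral_norm _).trans_eq ?_
  simp

theorem lintegral_mul_sq_le {α : Type*} [MeasurableSpace α] {μ : Measure α} {p r : α → ENNReal}
    (hp : AEMeasurable p μ) (hr : AEMeasurable r μ) :
    (∫⁻ x, p x * r x ∂μ) ^ 2 ≤ (∫⁻ x, p x ∂μ) * ∫⁻ x, p x * r x ^ 2 ∂μ := by
  have h := ENNReal.lintegral_mul_le_Lp_mul_Lq μ (p := 2) (q := 2)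
    (by norm_num [Real.holderConjugate_iff])
    (hp.pow_const (1 / 2 : ℝ)) ((hp.pow_const (1 / 2 : ℝ)).mul hr)
  have e (a : ENNReal) : a ^ (1 / 2 : ℝ) * a ^ (1 / 2 : ℝ) = a := by
    rw [← ENNReal.rpow_add_of_nonneg _ _ (by norm_num) (by norm_num)]; norm_num
  simp only [Pi.mul_apply, ← mul_assoc, e, ENNReal.rpow_two, mul_pow] at h
  simp only [pow_two, e] at h ⊢
  refine (mul_le_mul' h h).trans_eq ?_
  rw [mul_mul_mul_comm, e, e]

/-- **Young's inequality** `L¹ * L² ⊆ L²` for nonnegative functions on the line. -/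
theorem lintegral_conv_sq_le {p q : ℝ → ENNReal} (hp : Measurable p) (hq : Measurable q) :
    ∫⁻ ξ, (∫⁻ η, p η * q (ξ - η)) ^ 2 ≤ (∫⁻ η, p η) ^ 2 * ∫⁻ ξ, q ξ ^ 2 := by
  calc ∫⁻ ξ, (∫⁻ η, p η * q (ξ - η)) ^ 2
      ≤ ∫⁻ ξ, (∫⁻ η, p η) * ∫⁻ η, p η * q (ξ - η) ^ 2 :=
        lintegral_mono fun ξ => lintegral_mul_sq_le hp.aemeasurable (by fun_prop)
    _ = (∫⁻ η, p η) * ∫⁻ ξ, ∫⁻ η, p η * q (ξ - η) ^ 2 :=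
        lintegral_const_mul _ (by fun_prop)
    _ = (∫⁻ η, p η) * ∫⁻ η, ∫⁻ ξ, p η * q (ξ - η) ^ 2 := by
        rw [lintegral_lintegral_swap]; fun_prop
    _ = (∫⁻ η, p η) * ∫⁻ η, p η * ∫⁻ ξ, q ξ ^ 2 := by
        congr 2; ext η
        rw [lintegral_const_mul _ (by fun_prop), lintegral_sub_right_eq_self (fun x => q x ^ 2)]
    _ = _ := by rw [lintegral_mul_const _ hp]; ring

theorem ENNReal.two_mul_mul_le_sq_add_sq (a b : ENNReal) : 2 * (a * b) ≤ a ^ 2 + b ^ 2 := by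
  rcases eq_or_ne a ⊤ with rfl | ha
  · simp
  rcases eq_or_ne b ⊤ with rfl | hb
  · simp
  lift a to NNReal using ha
  lift b to NNReal using hb
  have : 2 * (a * b) ≤ a ^ 2 + b ^ 2 := by
    rw [← NNReal.coe_le_coe]; push_cast; nlinarith [sq_nonneg ((a : ℝ) - b)]
  exact_mod_cast this

/-- The Schur test function of Hilbert's kernel. -/
theorem lintegral_hilbert_kernel_le (η : ℝ) :
    ∫⁻ ζ, ENNReal.ofReal (√η / √ζ / (η + ζ)) ≤ ENNReal.ofReal π := by
  rcases le_or_gt η 0 with hη | hη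
  · simp [Real.sqrt_eq_zero_of_nonpos hη]
  have hd : ∀ x ∈ Set.Ioi (0 : ℝ),
      HasDerivAt (fun ζ => 2 * arctan (√ζ / √η)) (√η / √x / (η + x)) x := by
    intro x hx
    have hx : 0 < x := hx
    have h := ((((hasDerivAt_id x).sqrt hx.ne').div_const √η).arctan).const_mul 2
    convert! h using 1
    have h1 := Real.sq_sqrt hη.le
    have h2 := Real.sq_sqrt hx.le
    have h3 := Real.sqrt_pos.2 hη
    have h4 := Real.sqrt_pos.2 hx
    simp only [id, div_pow, h1, h2]
    field_simp
    rw [h1]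
  have hpos : ∀ x ∈ Set.Ioi (0 : ℝ), 0 ≤ √η / √x / (η + x) := by
    intro x hx
    have hx : 0 < x := hx
    positivity
  have hlim : Tendsto (fun ζ => 2 * arctan (√ζ / √η)) atTop (𝓝 π) := by
    have h := (tendsto_arctan_atTop.mono_right nhdsWithin_le_nhds).comp
      (Real.tendsto_sqrt_atTop.atTop_div_const (Real.sqrt_pos.2 hη))
    convert! h.const_mul 2 using 2
    ring
  have hc : ContinuousWithinAt (fun ζ => 2 * arctan (√ζ / √η)) (Set.Ici 0) 0 :=
    Continuous.continuousWithinAt (by fun_prop)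
  have hi := integrableOn_Ioi_deriv_of_nonneg hc hd hpos hlim
  calc ∫⁻ ζ, ENNReal.ofReal (√η / √ζ / (η + ζ))
      = ∫⁻ ζ in Set.Ioi 0, ENNReal.ofReal (√η / √ζ / (η + ζ)) := by
        refine (setLIntegral_eq_of_support_subset ?_).symm
        intro ζ hζ
        by_contra h
        exact hζ (by simp [Real.sqrt_eq_zero_of_nonpos (not_lt.1 h)])
    _ = ENNReal.ofReal (∫ ζ in Set.Ioi 0, √η / √ζ / (η + ζ)) :=
        (ofReal_integral_eq_lintegral_ofReal hi
          ((ae_restrict_iff' measurableSet_Ioi).2 (Eventually.of_forall hpos))).symm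
    _ ≤ _ := by
        rw [integral_Ioi_of_hasDerivAt_of_nonneg hc hd hpos hlim]
        simp

/-- **Hilbert's inequality** for functions supported on the positive half-line. -/
theorem lintegral_hilbert_le {A : ℝ → ENNReal} (hA : Measurable A) (hA0 : ∀ x ≤ 0, A x = 0) :
    ∫⁻ η, ∫⁻ ζ, A η * A ζ * ENNReal.ofReal (1 / (η + ζ)) ≤
      ENNReal.ofReal π * ∫⁻ η, A η ^ 2 := by
  have hm : Measurable fun p : ℝ × ℝ => A p.1 ^ 2 * ENNReal.ofReal (√p.1 / √p.2 / (p.1 + p.2)) := by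
    fun_prop
  have hX : ∫⁻ η, ∫⁻ ζ, A η ^ 2 * ENNReal.ofReal (√η / √ζ / (η + ζ)) ≤
      ENNReal.ofReal π * ∫⁻ η, A η ^ 2 := by
    rw [← lintegral_const_mul _ (by fun_prop)]
    refine lintegral_mono fun η => ?_
    dsimp only
    rw [lintegral_const_mul _ (by fun_prop), mul_comm]
    exact mul_le_mul' (lintegral_hilbert_kernel_le η) le_rfl
  have hY : ∫⁻ η, ∫⁻ ζ, A ζ ^ 2 * ENNReal.ofReal (√ζ / √η / (ζ + η)) ≤
      ENNReal.ofReal π * ∫⁻ η, A η ^ 2 := by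
    rw [lintegral_lintegral_swap]
    · exact hX
    · exact (hm.comp measurable_swap).aemeasurable
  have hpt (η ζ : ℝ) : 2 * (A η * A ζ * ENNReal.ofReal (1 / (η + ζ))) ≤
      A η ^ 2 * ENNReal.ofReal (√η / √ζ / (η + ζ)) +
        A ζ ^ 2 * ENNReal.ofReal (√ζ / √η / (ζ + η)) := by
    rcases le_or_gt η 0 with hη | hη
    · simp [hA0 η hη]
    rcases le_or_gt ζ 0 with hζ | hζ
    · simp [hA0 ζ hζ]
    have h3 := Real.sqrt_pos.2 hη
    have h4 := Real.sqrt_pos.2 hζ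
    have h := ENNReal.two_mul_mul_le_sq_add_sq (A η * ENNReal.ofReal √(√η / √ζ / (η + ζ)))
      (A ζ * ENNReal.ofReal √(√ζ / √η / (ζ + η)))
    rw [mul_mul_mul_comm, ← ENNReal.ofReal_mul (by positivity), ← Real.sqrt_mul (by positivity),
      mul_pow, mul_pow, ← ENNReal.ofReal_pow (by positivity), ← ENNReal.ofReal_pow (by positivity),
      Real.sq_sqrt (by positivity), Real.sq_sqrt (by positivity)] at h
    convert h using 4
    rw [eq_comm, Real.sqrt_eq_iff_mul_self_eq (by positivity) (by positivity)]
    field_simp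
    ring
  have h2 : 2 * ∫⁻ η, ∫⁻ ζ, A η * A ζ * ENNReal.ofReal (1 / (η + ζ)) ≤
      2 * (ENNReal.ofReal π * ∫⁻ η, A η ^ 2) := by
    calc 2 * ∫⁻ η, ∫⁻ ζ, A η * A ζ * ENNReal.ofReal (1 / (η + ζ))
        = ∫⁻ η, ∫⁻ ζ, 2 * (A η * A ζ * ENNReal.ofReal (1 / (η + ζ))) := by
          rw [← lintegral_const_mul _ (by fun_prop)]
          congr 1; ext η
          rw [← lintegral_const_mul _ (by fun_prop)]
      _ ≤ ∫⁻ η, ∫⁻ ζ, (A η ^ 2 * ENNReal.ofReal (√η / √ζ / (η + ζ)) +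
            A ζ ^ 2 * ENNReal.ofReal (√ζ / √η / (ζ + η))) :=
          lintegral_mono fun η => lintegral_mono fun ζ => hpt η ζ
      _ = (∫⁻ η, ∫⁻ ζ, A η ^ 2 * ENNReal.ofReal (√η / √ζ / (η + ζ))) +
            ∫⁻ η, ∫⁻ ζ, A ζ ^ 2 * ENNReal.ofReal (√ζ / √η / (ζ + η)) := by
          rw [← lintegral_add_left (by fun_prop)]
          congr 1; ext η
          rw [← lintegral_add_left (by fun_prop)]
      _ ≤ _ := by rw [two_mul]; exact add_le_add hX hY
  exact (ENNReal.mul_le_mul_iff_right (by norm_num) (by norm_num)).1 h2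

theorem eLpNorm_two_sq {f : ℝ → ℂ} : eLpNorm f 2 ^ 2 = ∫⁻ ξ, ‖f ξ‖ₑ ^ 2 := by
  simpa using eLpNorm_nnreal_pow_eq_lintegral (f := f) (μ := volume) (p := 2) (by norm_num)

theorem integrable_mul_pow_fourierInv {f G : ℝ → ℂ} (hf : Integrable f) (hG : Integrable G)
    (n : ℕ) : Integrable (fun x => f x * 𝓕⁻ G x ^ n) := by
  refine hf.mul_bdd (c := (∫ ξ, ‖G ξ‖) ^ n)
    ((continuous_fourierInv_of_integrable hG).pow n).aestronglyMeasurable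
    (Eventually.of_forall fun x => ?_)
  rw [norm_pow]
  exact pow_le_pow_left₀ (norm_nonneg _) (norm_fourierInv_le x) n

theorem eLpNorm_le_of_enorm_le_conv {F p q : ℝ → ℂ} {k : ENNReal} (hp : Measurable p)
    (hq : Measurable q) (h : ∀ ξ, ‖F ξ‖ₑ ≤ k * ∫⁻ η, ‖p η‖ₑ * ‖q (ξ - η)‖ₑ) :
    eLpNorm F 2 ≤ k * (∫⁻ η, ‖p η‖ₑ) * eLpNorm q 2 := by
  refine (ENNReal.pow_le_pow_left_iff two_ne_zero).1 ?_
  rw [mul_pow, mul_pow, eLpNorm_two_sq, eLpNorm_two_sq, mul_assoc]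
  calc ∫⁻ ξ, ‖F ξ‖ₑ ^ 2
      ≤ ∫⁻ ξ, k ^ 2 * (∫⁻ η, ‖p η‖ₑ * ‖q (ξ - η)‖ₑ) ^ 2 :=
        lintegral_mono fun ξ => (pow_le_pow_left' (h ξ) 2).trans_eq (mul_pow _ _ _)
    _ = k ^ 2 * ∫⁻ ξ, (∫⁻ η, ‖p η‖ₑ * ‖q (ξ - η)‖ₑ) ^ 2 :=
        lintegral_const_mul _ (by fun_prop)
    _ ≤ _ := mul_le_mul' le_rfl
        (lintegral_conv_sq_le (p := fun η => ‖p η‖ₑ) (q := fun ξ => ‖q ξ‖ₑ) hp.enorm hq.enorm)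

/-- Multiplication by an inverse Fourier transform, in a weighted `L²` norm with a submultiplicative
weight on the Fourier side. -/
theorem eLpNorm_weight_fourier_mul_fourierInv_le {w : ℝ → ℝ} (hw : Continuous w) {K : ℝ}
    (hw0 : ∀ x, 0 ≤ w x) (hK0 : 0 ≤ K) (hK : ∀ x y, w (x + y) ≤ K * w x * w y)
    {f G : ℝ → ℂ} (hf : Integrable f) (hG : Integrable G) (hGm : Measurable G) {B : ℝ}
    (hB : ∫⁻ η, ‖(w η : ℂ) * G η‖ₑ ≤ ENNReal.ofReal B) :
    eLpNorm (fun ξ => (w ξ : ℂ) * 𝓕 (fun x => f x * 𝓕⁻ G x) ξ) 2 ≤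
      ENNReal.ofReal (K * B) * eLpNorm (fun ξ => (w ξ : ℂ) * 𝓕 f ξ) 2 := by
  have hfm := (continuous_fourier_of_integrable hf).measurable
  have hwm := hw.measurable
  have hpt (ξ : ℝ) : ‖(w ξ : ℂ) * 𝓕 (fun x => f x * 𝓕⁻ G x) ξ‖ₑ ≤ ENNReal.ofReal K *
      ∫⁻ η, ‖(w η : ℂ) * G η‖ₑ * ‖(w (ξ - η) : ℂ) * 𝓕 f (ξ - η)‖ₑ := by
    rw [enorm_mul, ← lintegral_const_mul _ (by fun_prop)]
    refine (mul_le_mul' le_rfl (enorm_fourier_mul_fourierInv_le hf hG ξ)).trans ?_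
    rw [← lintegral_const_mul _ (by fun_prop)]
    refine lintegral_mono fun η => ?_
    have he (x : ℝ) : ‖(w x : ℂ)‖ₑ = ENNReal.ofReal (w x) := by
      rw [← ofReal_norm, Complex.norm_real, Real.norm_of_nonneg (hw0 x)]
    have h1 : ENNReal.ofReal (w ξ) ≤
        ENNReal.ofReal K * ENNReal.ofReal (w η) * ENNReal.ofReal (w (ξ - η)) := by
      rw [← ENNReal.ofReal_mul hK0, ← ENNReal.ofReal_mul (mul_nonneg hK0 (hw0 _))]
      exact ENNReal.ofReal_le_ofReal (by simpa using hK η (ξ - η))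
    simp only [enorm_mul, he]
    refine (mul_le_mul' h1 le_rfl).trans_eq ?_
    ring
  rw [ENNReal.ofReal_mul hK0]
  refine (eLpNorm_le_of_enorm_le_conv (p := fun η => (w η : ℂ) * G η)
    (q := fun ξ => (w ξ : ℂ) * 𝓕 f ξ) (by fun_prop) (by fun_prop) hpt).trans ?_
  exact mul_le_mul' (mul_le_mul' le_rfl hB) le_rfl

theorem hasSum_fourier_mul_exp_fourierInv {f G : ℝ → ℂ} (hf : Integrable f) (hG : Integrable G)
    (ξ : ℝ) : HasSum (fun n : ℕ => ((n.factorial : ℂ))⁻¹ * 𝓕 (fun x => f x * 𝓕⁻ G x ^ n) ξ)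
      (𝓕 (fun x => f x * Complex.exp (𝓕⁻ G x)) ξ) := by
  have hint (n : ℕ) := integrable_mul_pow_fourierInv hf hG n
  have hmain := hasSum_integral_of_summable_integral_norm (μ := volume)
    (F := fun (n : ℕ) (x : ℝ) => 𝐞 (-(x * ξ)) • ((n.factorial : ℂ)⁻¹ * (f x * 𝓕⁻ G x ^ n)))
    (fun n => by
      simpa [mul_comm] using! (Real.fourierIntegral_convergent_iff ξ).2 ((hint n).const_mul _)) ?_
  · convert! hmain using 1
    · ext n
      rw [Real.fourier_real_eq, ← integral_const_mul]
      congr 1; ext x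
      simp only [Circle.smul_def, smul_eq_mul]; ring
    · rw [Real.fourier_real_eq]
      congr 1; ext x
      refine (HasSum.tsum_eq ?_).symm
      have := ((NormedSpace.expSeries_div_hasSum_exp (𝓕⁻ G x)).mul_left (f x)).mul_left
        (𝐞 (-(x * ξ)) : ℂ)
      rw [← Complex.exp_eq_exp_ℂ] at this
      convert! this using 1
      ext n
      simp only [Circle.smul_def, smul_eq_mul]; ring
  · refine Summable.of_nonneg_of_le (fun n => integral_nonneg fun x => norm_nonneg _) (fun n => ?_)
      ((Real.summable_pow_div_factorial (∫ ξ, ‖G ξ‖)).mul_left (∫ x, ‖f x‖))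
    calc ∫ x, ‖𝐞 (-(x * ξ)) • ((n.factorial : ℂ)⁻¹ * (f x * 𝓕⁻ G x ^ n))‖
        ≤ ∫ x, ‖f x‖ * ((∫ ξ, ‖G ξ‖) ^ n / n.factorial) := by
          refine integral_mono_of_nonneg (Eventually.of_forall fun x => norm_nonneg _)
            (hf.norm.mul_const _) (Eventually.of_forall fun x => ?_)
          simp only [Circle.norm_smul, norm_mul, norm_pow, norm_inv, Complex.norm_natCast]
          rw [mul_left_comm, div_eq_inv_mul]
          gcongr
          exact norm_fourierInv_le x
      _ = _ := integral_mul_const _ _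

theorem eLpNorm_inv_factorial_smul_le {F : ℝ → ℂ} {r : ℝ} {N : ENNReal} (n : ℕ)
    (hN : eLpNorm F 2 ≤ ENNReal.ofReal (r ^ n) * N) :
    eLpNorm ((n.factorial : ℂ)⁻¹ • F) 2 ≤ ENNReal.ofReal (r ^ n / n.factorial) * N := by
  rw [eLpNorm_const_smul, div_eq_inv_mul, ENNReal.ofReal_mul (by positivity), mul_assoc]
  refine mul_le_mul' (le_of_eq ?_) hN
  rw [← ofReal_norm]
  simp

theorem sum_ofReal_pow_div_factorial_mul_le {r : ℝ} (hr : 0 ≤ r) (N : ENNReal) (m : ℕ) :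
    ∑ n ∈ Finset.range m, ENNReal.ofReal (r ^ n / n.factorial) * N ≤
      ENNReal.ofReal (Real.exp r) * N := by
  rw [← Finset.sum_mul, ← ENNReal.ofReal_sum_of_nonneg (fun n _ => by positivity)]
  exact mul_le_mul' (ENNReal.ofReal_le_ofReal (Real.sum_le_exp_of_nonneg hr m)) le_rfl

theorem eLpNorm_sum_inv_factorial_smul_le {F : ℕ → ℝ → ℂ} (hF : ∀ n, AEStronglyMeasurable (F n))
    {r : ℝ} (hr : 0 ≤ r) {N : ENNReal} (hN : ∀ n, eLpNorm (F n) 2 ≤ ENNReal.ofReal (r ^ n) * N)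
    (m : ℕ) : eLpNorm (∑ n ∈ Finset.range m, (n.factorial : ℂ)⁻¹ • F n) 2 ≤
      ENNReal.ofReal (Real.exp r) * N := by
  refine (eLpNorm_sum_le (p := 2) (fun n _ => (hF n).const_smul _) one_le_two).trans ?_
  exact (Finset.sum_le_sum fun n _ => eLpNorm_inv_factorial_smul_le n (hN n)).trans
    (sum_ofReal_pow_div_factorial_mul_le hr N m)

theorem eLpNorm_le_of_hasSum_div_factorial {F : ℕ → ℝ → ℂ} {f : ℝ → ℂ}
    (hF : ∀ n, AEStronglyMeasurable (F n))
    (h : ∀ ξ, HasSum (fun n => (n.factorial : ℂ)⁻¹ * F n ξ) (f ξ)) {r : ℝ} (hr : 0 ≤ r)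
    {N : ENNReal} (hN : ∀ n, eLpNorm (F n) 2 ≤ ENNReal.ofReal (r ^ n) * N) :
    eLpNorm f 2 ≤ ENNReal.ofReal (Real.exp r) * N := by
  have hF' (n : ℕ) : AEStronglyMeasurable ((n.factorial : ℂ)⁻¹ • F n) := (hF n).const_smul _
  have hlim (ξ : ℝ) : Tendsto (fun m => (∑ n ∈ Finset.range m, (n.factorial : ℂ)⁻¹ • F n) ξ)
      atTop (𝓝 (f ξ)) := by
    simpa only [Finset.sum_apply, Pi.smul_apply, smul_eq_mul] using (h ξ).tendsto_sum_nat
  refine (Lp.eLpNorm_lim_le_liminf_eLpNorm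
    (fun m => Finset.aestronglyMeasurable_sum (Finset.range m) fun n _ => hF' n) f
    (Eventually.of_forall hlim)).trans
    (liminf_le_of_frequently_le' (Frequently.of_forall fun m => ?_))
  exact eLpNorm_sum_inv_factorial_smul_le hF hr hN m

theorem eLpNorm_weight_fourier_mul_exp_le {w : ℝ → ℝ} (hw : Continuous w) {K : ℝ}
    (hw0 : ∀ x, 0 ≤ w x) (hK0 : 0 ≤ K) (hK : ∀ x y, w (x + y) ≤ K * w x * w y)
    {f G : ℝ → ℂ} (hf : Integrable f) (hG : Integrable G) (hGm : Measurable G) {B : ℝ}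
    (hB0 : 0 ≤ B) (hB : ∫⁻ η, ‖(w η : ℂ) * G η‖ₑ ≤ ENNReal.ofReal B) :
    eLpNorm (fun ξ => (w ξ : ℂ) * 𝓕 (fun x => f x * Complex.exp (𝓕⁻ G x)) ξ) 2 ≤
      ENNReal.ofReal (Real.exp (K * B)) * eLpNorm (fun ξ => (w ξ : ℂ) * 𝓕 f ξ) 2 := by
  have hint (n : ℕ) := integrable_mul_pow_fourierInv hf hG n
  have hKB : 0 ≤ K * B := mul_nonneg hK0 hB0
  set N := eLpNorm (fun ξ => (w ξ : ℂ) * 𝓕 f ξ) 2 with hN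
  have hpow (n : ℕ) : eLpNorm (fun ξ => (w ξ : ℂ) * 𝓕 (fun x => f x * 𝓕⁻ G x ^ n) ξ) 2 ≤
      ENNReal.ofReal ((K * B) ^ n) * N := by
    induction n with
    | zero => simp [hN]
    | succ n ih =>
      have h := eLpNorm_weight_fourier_mul_fourierInv_le hw hw0 hK0 hK (hint n) hG hGm hB
      simp only [mul_assoc, ← pow_succ] at h
      refine h.trans ((mul_le_mul' le_rfl ih).trans_eq ?_)
      rw [← mul_assoc, ← ENNReal.ofReal_mul (by positivity), pow_succ']
  refine eLpNorm_le_of_hasSum_div_factorial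
    (F := fun n ξ => (w ξ : ℂ) * 𝓕 (fun x => f x * 𝓕⁻ G x ^ n) ξ) (fun n => ?_)
    (fun ξ => ?_) hKB hpow
  · have := continuous_fourier_of_integrable (hint n)
    exact Continuous.aestronglyMeasurable (by fun_prop)
  · simpa only [mul_left_comm] using
      (hasSum_fourier_mul_exp_fourierInv hf hG ξ).mul_left (w ξ : ℂ)

theorem fourier_mul_fourierInv_eq_zero {f G : ℝ → ℂ} (hf : Integrable f) (hG : Integrable G)
    {a b : ℝ} (hf0 : ∀ ξ < a, 𝓕 f ξ = 0) (hG0 : ∀ ξ < b, G ξ = 0) {ξ : ℝ} (hξ : ξ < a + b) :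
    𝓕 (fun x => f x * 𝓕⁻ G x) ξ = 0 := by
  rw [fourier_mul_fourierInv hf hG]
  refine integral_eq_zero_of_ae (Eventually.of_forall fun η => ?_)
  rcases lt_or_ge η b with h | h
  · simp [hG0 η h]
  · simp [hf0 (ξ - η) (by linarith)]

theorem fourier_mul_exp_fourierInv_eq_zero {f G : ℝ → ℂ} (hf : Integrable f) (hG : Integrable G)
    (hf0 : ∀ ξ < 0, 𝓕 f ξ = 0) (hG0 : ∀ ξ < 0, G ξ = 0) {ξ : ℝ} (hξ : ξ < 0) :
    𝓕 (fun x => f x * Complex.exp (𝓕⁻ G x)) ξ = 0 := by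
  have h (n : ℕ) : ∀ ξ < 0, 𝓕 (fun x => f x * 𝓕⁻ G x ^ n) ξ = 0 := by
    induction n with
    | zero => simpa using hf0
    | succ n ih =>
      intro ξ hξ
      simpa only [mul_assoc, ← pow_succ] using fourier_mul_fourierInv_eq_zero
        (integrable_mul_pow_fourierInv hf hG n) hG ih hG0 (by simpa using hξ)
  refine (hasSum_fourier_mul_exp_fourierInv hf hG ξ).unique ?_
  simp [h _ ξ hξ]

theorem hasDerivAt_fourierInv {g : ℝ → ℂ} (hg : Integrable g)
    (hg' : Integrable fun ξ : ℝ => (2 * π * Complex.I * ξ) * g ξ) (x : ℝ) :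
    HasDerivAt (𝓕⁻ g) (𝓕⁻ (fun ξ : ℝ => (2 * π * Complex.I * ξ) * g ξ) x) x := by
  have hg'' : Integrable fun ξ : ℝ => ξ • g ξ := by
    refine (hg'.const_mul (2 * π * Complex.I)⁻¹).congr (Eventually.of_forall fun ξ => ?_)
    have := Complex.two_pi_I_ne_zero
    simp only [Complex.real_smul]
    field_simp
  have h := (Real.hasDerivAt_fourier hg hg'' (-x)).scomp x (hasDerivAt_neg x)
  have e : 𝓕⁻ g = 𝓕 g ∘ Neg.neg := funext fun x => Real.fourierInv_eq_fourier_neg g x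
  rw [e, Real.fourierInv_eq_fourier_neg]
  convert! h using 1
  rw [neg_one_smul, Real.fourier_real_eq, Real.fourier_real_eq, ← integral_neg]
  congr 1; ext ξ
  simp only [Circle.smul_def, smul_eq_mul]; ring

theorem pinv_eq_of_hasDerivAt {f h : ℝ → ℂ} (hf : Integrable f)
    (hd : ∀ x, HasDerivAt h (f x) x) (hlim : Tendsto h (cocompact ℝ) (𝓝 0)) (x : ℝ) :
    pinv f x = h x := by
  rw [cocompact_eq_atBot_atTop, tendsto_sup] at hlim
  rw [pinv, integral_Ici_eq_integral_Ioi,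
    integral_Iic_of_hasDerivAt_of_tendsto' (fun x _ => hd x) hf.integrableOn hlim.1,
    integral_Ioi_of_hasDerivAt_of_tendsto' (fun x _ => hd x) hf.integrableOn hlim.2]
  ring

theorem integrable_inv_mul_of_eq_zero {g : ℝ → ℂ} (hg : Integrable g) {a : ℝ} (ha : 0 < a)
    (hg0 : ∀ ξ < a, g ξ = 0) : Integrable fun ξ : ℝ => (2 * π * Complex.I * ξ)⁻¹ * g ξ := by
  refine (hg.norm.const_mul (2 * π * a)⁻¹).mono' ?_ (Eventually.of_forall fun ξ => ?_)
  · exact (Measurable.aestronglyMeasurable (by fun_prop)).mul hg.aestronglyMeasurable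
  · rcases lt_or_ge ξ a with h | h
    · simp [hg0 ξ h]
    · rw [norm_mul]
      refine mul_le_mul_of_nonneg_right ?_ (norm_nonneg _)
      have : 0 < ξ := ha.trans_le h
      simp only [norm_inv, norm_mul, Complex.norm_real, Complex.norm_I, Complex.norm_ofNat,
        Real.norm_of_nonneg pi_pos.le, Real.norm_of_nonneg this.le, mul_one]
      gcongr

theorem pinv_eq_fourierInv {f : ℝ → ℂ} (hf : Integrable f) (hfc : Continuous f)
    (hF : Integrable (𝓕 f)) {a : ℝ} (ha : 0 < a) (hF0 : ∀ ξ < a, 𝓕 f ξ = 0) (x : ℝ) :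
    pinv f x = 𝓕⁻ (fun ξ : ℝ => (2 * π * Complex.I * ξ)⁻¹ * 𝓕 f ξ) x := by
  have e : (fun ξ : ℝ => (2 * π * Complex.I * ξ) * ((2 * π * Complex.I * ξ)⁻¹ * 𝓕 f ξ)) = 𝓕 f := by
    ext ξ
    rcases lt_or_ge ξ a with h | h
    · simp [hF0 ξ h]
    · have : (ξ : ℂ) ≠ 0 := by exact_mod_cast (ha.trans_le h).ne'
      exact mul_inv_cancel_left₀ (mul_ne_zero Complex.two_pi_I_ne_zero this) _
  have hG := integrable_inv_mul_of_eq_zero hF ha hF0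
  refine pinv_eq_of_hasDerivAt hf (fun x => ?_) ?_ x
  · have h := hasDerivAt_fourierInv hG (by rwa [e]) x
    rwa [e, hfc.fourierInv_fourier_eq hf hF] at h
  · rw [Real.fourierInv_eq_fourier_comp_neg]
    exact Real.zero_at_infty_fourier _

theorem fourier_conj_comp_neg (u : ℝ → ℂ) (ξ : ℝ) :
    𝓕 (fun x => (starRingEnd ℂ) (u (-x))) ξ = (starRingEnd ℂ) (𝓕 u ξ) := by
  rw [Real.fourier_real_eq, Real.fourier_real_eq, ← integral_conj,
    ← integral_neg_eq_self (fun x => (starRingEnd ℂ) (𝐞 (-(x * ξ)) • u x))]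
  congr 1; ext x
  simp [Circle.smul_def, ← Circle.coe_inv_eq_conj, AddChar.map_neg_eq_inv]

/-- The product of `u` and `u*` as a Schwartz function. -/
theorem exists_schwartzMap_mul_conj_comp_neg (u : SchwartzMap ℝ ℂ) :
    ∃ v F : SchwartzMap ℝ ℂ, (∀ x, v x = (starRingEnd ℂ) (u (-x))) ∧
      ∀ x, F x = u x * (starRingEnd ℂ) (u (-x)) := by
  let v := SchwartzMap.postcompCLM (𝕜 := ℝ) (Complex.conjCLE : ℂ →L[ℝ] ℂ)
    (SchwartzMap.compCLMOfContinuousLinearEquiv ℝ (ContinuousLinearEquiv.neg ℝ (M := ℝ)) u)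
  exact ⟨v, SchwartzMap.pairing (ContinuousLinearMap.mul ℝ ℂ) u v, fun x => rfl, fun x => rfl⟩

theorem Enorm_eq_toReal_eLpNorm {s σ : ℝ} {f : ℝ → ℂ} (hf : Measurable (𝓕 f))
    (hf0 : ∀ ξ < 0, 𝓕 f ξ = 0) : Enorm s σ f =
      (eLpNorm (fun ξ : ℝ => (((1 + ξ ^ 2) ^ (σ / 2) * (2 : ℝ) ^ (s * ξ) : ℝ) : ℂ) * 𝓕 f ξ)
        2).toReal := by
  have h : ∫⁻ ξ : ℝ, ENNReal.ofReal ((1 + ξ ^ 2) ^ σ * (2 : ℝ) ^ (2 * s * |ξ|) * ‖𝓕 f ξ‖ ^ 2) =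
      eLpNorm (fun ξ : ℝ => (((1 + ξ ^ 2) ^ (σ / 2) * (2 : ℝ) ^ (s * ξ) : ℝ) : ℂ) * 𝓕 f ξ)
        2 ^ 2 := by
    rw [eLpNorm_two_sq]
    congr 1; ext ξ
    rw [← ofReal_norm, ← ENNReal.ofReal_pow (norm_nonneg _), norm_mul, Complex.norm_real,
      Real.norm_of_nonneg (by positivity), mul_pow, mul_pow]
    rcases lt_or_ge ξ 0 with hξ | hξ
    · simp [hf0 ξ hξ]
    · rw [abs_of_nonneg hξ, ← Real.rpow_mul_natCast (by positivity),
        ← Real.rpow_mul_natCast (by positivity)]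
      congr 4
      · push_cast; ring
      · push_cast; ring
  rw [Enorm, integral_eq_lintegral_of_nonneg_ae (Eventually.of_forall fun ξ => by positivity)
    (Measurable.aestronglyMeasurable (by fun_prop)), h, ENNReal.toReal_pow, ← Real.sqrt_eq_rpow,
    Real.sqrt_sq ENNReal.toReal_nonneg]

theorem weight_add_le {σ s : ℝ} (hσ : 0 ≤ σ) (x y : ℝ) :
    (1 + (x + y) ^ 2) ^ (σ / 2) * (2 : ℝ) ^ (s * (x + y)) ≤
      (2 : ℝ) ^ (σ / 2) * ((1 + x ^ 2) ^ (σ / 2) * (2 : ℝ) ^ (s * x)) *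
        ((1 + y ^ 2) ^ (σ / 2) * (2 : ℝ) ^ (s * y)) := by
  have h : (1 + (x + y) ^ 2) ^ (σ / 2) ≤
      (2 : ℝ) ^ (σ / 2) * (1 + x ^ 2) ^ (σ / 2) * (1 + y ^ 2) ^ (σ / 2) := by
    rw [← Real.mul_rpow (by positivity) (by positivity),
      ← Real.mul_rpow (by positivity) (by positivity)]
    refine Real.rpow_le_rpow (by positivity) ?_ (by positivity)
    nlinarith [sq_nonneg (x - y), sq_nonneg (x * y)]
  rw [mul_add, Real.rpow_add two_pos]
  calc _ ≤ ((2 : ℝ) ^ (σ / 2) * (1 + x ^ 2) ^ (σ / 2) * (1 + y ^ 2) ^ (σ / 2)) *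
        ((2 : ℝ) ^ (s * x) * (2 : ℝ) ^ (s * y)) := by gcongr
    _ = _ := by ring

theorem eLpNorm_weight_mul_schwartz_lt_top {σ s : ℝ} (hs : s ≤ 0) (f : SchwartzMap ℝ ℂ)
    (hf0 : ∀ ξ < 0, f ξ = 0) :
    eLpNorm (fun ξ : ℝ => (((1 + ξ ^ 2) ^ (σ / 2) * (2 : ℝ) ^ (s * ξ) : ℝ) : ℂ) * f ξ) 2 < ⊤ := by
  have hT := Function.hasTemperateGrowth_one_add_norm_sq_rpow ℝ (σ / 2)
  refine (eLpNorm_mono fun ξ => ?_).trans_lt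
    (SchwartzMap.eLpNorm_lt_top 
      (SchwartzMap.smulLeftCLM ℂ (fun x : ℝ => (1 + ‖x‖ ^ 2) ^ (σ / 2)) f) 2 volume)
  rw [SchwartzMap.smulLeftCLM_apply_apply hT, norm_smul, norm_mul, Complex.norm_real]
  rcases lt_or_ge ξ 0 with hξ | hξ
  · simp [hf0 ξ hξ]
  · refine mul_le_mul_of_nonneg_right ?_ (norm_nonneg _)
    rw [Real.norm_of_nonneg (by positivity), Real.norm_of_nonneg (by positivity), Real.norm_eq_abs,
      sq_abs]
    exact mul_le_of_le_one_right (by positivity)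
      (Real.rpow_le_one_of_one_le_of_nonpos one_le_two (mul_nonpos_of_nonpos_of_nonneg hs hξ))

/-- The `L¹` bound that turns the antiderivative of a product into a multiplier. -/
theorem lintegral_weight_div_fourier_mul_fourierInv_le {w : ℝ → ℝ} (hw : Continuous w) {K : ℝ}
    (hw0 : ∀ x, 0 ≤ w x) (hK0 : 0 ≤ K) (hK : ∀ x y, w (x + y) ≤ K * w x * w y)
    {v U : ℝ → ℂ} (hv : Integrable v) (hU : Integrable U) (hUm : Measurable U)
    (hvU : ∀ ξ, ‖𝓕 v ξ‖ₑ = ‖U ξ‖ₑ) (hU0 : ∀ ξ ≤ 0, U ξ = 0)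
    (hF0 : ∀ ξ ≤ 0, 𝓕 (fun x => v x * 𝓕⁻ U x) ξ = 0) :
    ∫⁻ η, ‖(w η : ℂ) * ((2 * π * Complex.I * η)⁻¹ * 𝓕 (fun x => v x * 𝓕⁻ U x) η)‖ₑ ≤
      ENNReal.ofReal (K / 2) * eLpNorm (fun ξ => (w ξ : ℂ) * U ξ) 2 ^ 2 := by
  have hwm := hw.measurable
  set A : ℝ → ENNReal := fun ξ => ‖(w ξ : ℂ) * U ξ‖ₑ with hA
  have hAm : Measurable A := by fun_prop
  have he (x : ℝ) : ‖(w x : ℂ)‖ₑ = ENNReal.ofReal (w x) := by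
    rw [← ofReal_norm, Complex.norm_real, Real.norm_of_nonneg (hw0 x)]
  have hpt (η : ℝ) : ‖(w η : ℂ) * ((2 * π * Complex.I * η)⁻¹ * 𝓕 (fun x => v x * 𝓕⁻ U x) η)‖ₑ ≤
      ENNReal.ofReal (K / (2 * π)) * ∫⁻ ζ, A ζ * A (η - ζ) * ENNReal.ofReal (1 / η) := by
    rcases le_or_gt η 0 with hη | hη
    · simp [hF0 η hη]
    have h1 : ‖(2 * π * Complex.I * η : ℂ)⁻¹‖ₑ =
        ENNReal.ofReal (1 / (2 * π)) * ENNReal.ofReal (1 / η) := by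
      rw [← ofReal_norm, ← ENNReal.ofReal_mul (by positivity)]
      congr 1
      simp [abs_of_pos hη, abs_of_pos pi_pos]
      ring
    rw [enorm_mul, enorm_mul, h1, ← lintegral_const_mul _ (by fun_prop)]
    refine (mul_le_mul' le_rfl (mul_le_mul' le_rfl
      (enorm_fourier_mul_fourierInv_le hv hU η))).trans ?_
    simp only [hvU]
    rw [← lintegral_const_mul _ (by fun_prop), ← lintegral_const_mul _ (by fun_prop)]
    refine lintegral_mono fun ζ => ?_
    have h2 : ENNReal.ofReal (w η) ≤
        ENNReal.ofReal K * ENNReal.ofReal (w ζ) * ENNReal.ofReal (w (η - ζ)) := by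
      rw [← ENNReal.ofReal_mul hK0, ← ENNReal.ofReal_mul (mul_nonneg hK0 (hw0 _))]
      exact ENNReal.ofReal_le_ofReal (by simpa using hK ζ (η - ζ))
    simp only [hA, enorm_mul, he, div_eq_mul_one_div K, ENNReal.ofReal_mul hK0]
    refine (mul_le_mul' h2 le_rfl).trans_eq ?_
    ring
  calc _ ≤ ∫⁻ η, ENNReal.ofReal (K / (2 * π)) *
        ∫⁻ ζ, A ζ * A (η - ζ) * ENNReal.ofReal (1 / η) := lintegral_mono hpt
    _ = ENNReal.ofReal (K / (2 * π)) * ∫⁻ η, ∫⁻ ζ, A ζ * A (η - ζ) * ENNReal.ofReal (1 / η) :=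
        lintegral_const_mul _ (by fun_prop)
    _ = ENNReal.ofReal (K / (2 * π)) * ∫⁻ ζ, ∫⁻ η, A ζ * A (η - ζ) * ENNReal.ofReal (1 / η) := by
        rw [lintegral_lintegral_swap]; fun_prop
    _ = ENNReal.ofReal (K / (2 * π)) * ∫⁻ ζ, ∫⁻ η, A ζ * A η * ENNReal.ofReal (1 / (ζ + η)) := by
        congr 2; ext ζ
        rw [← lintegral_add_right_eq_self _ ζ]
        congr 1; ext η
        rw [add_sub_cancel_right, add_comm ζ]
    _ ≤ ENNReal.ofReal (K / (2 * π)) * (ENNReal.ofReal π * ∫⁻ ζ, A ζ ^ 2) :=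
        mul_le_mul' le_rfl (lintegral_hilbert_le hAm fun x hx => by simp [hA, hU0 x hx])
    _ = _ := by
        rw [eLpNorm_two_sq, ← mul_assoc, ← ENNReal.ofReal_mul (by positivity)]
        congr 2
        field_simp

theorem fourierInv_const_mul (c : ℂ) (g : ℝ → ℂ) (x : ℝ) :
    𝓕⁻ (fun ξ => c * g ξ) x = c * 𝓕⁻ g x := by
  rw [Real.fourierInv_eq, Real.fourierInv_eq, ← integral_const_mul]
  simp only [Circle.smul_def, smul_eq_mul, mul_left_comm]

/-- The exponent of the gauge transform is an inverse Fourier transform, of a function supported on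
the positive half-line whose weighted `L¹` norm is controlled by the weighted `L²` norm of `𝓕 u`. -/
theorem exists_gaugeT_eq_mul_exp_fourierInv {w : ℝ → ℝ} (hw : Continuous w) {K : ℝ}
    (hw0 : ∀ x, 0 ≤ w x) (hK0 : 0 ≤ K) (hK : ∀ x y, w (x + y) ≤ K * w x * w y)
    {ε : ℝ} (hε : 0 < ε) (δ : ℝ) (u : SchwartzMap ℝ ℂ) (hu : ∀ ξ < ε, 𝓕 (⇑u) ξ = 0) :
    ∃ G : ℝ → ℂ, Integrable G ∧ Measurable G ∧ (∀ ξ < 0, G ξ = 0) ∧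
      gaugeT δ ⇑u = (fun x => u x * Complex.exp (𝓕⁻ G x)) ∧
      ∫⁻ η, ‖(w η : ℂ) * G η‖ₑ ≤
        ENNReal.ofReal (|δ| * K / 2) * eLpNorm (fun ξ => (w ξ : ℂ) * 𝓕 (⇑u) ξ) 2 ^ 2 := by
  obtain ⟨v, F, hv, hF⟩ := exists_schwartzMap_mul_conj_comp_neg u
  have hvu (ξ : ℝ) : 𝓕 (⇑v) ξ = (starRingEnd ℂ) (𝓕 (⇑u) ξ) := by
    rw [← fourier_conj_comp_neg, ← funext hv]
  have hU : Integrable (𝓕 ⇑u) := (𝓕 u).integrable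
  have hFv : ⇑F = fun x => v x * 𝓕⁻ (𝓕 ⇑u) x := by
    ext x
    rw [u.continuous.fourierInv_fourier_eq u.integrable hU, hF, hv, mul_comm]
  have hF0 : ∀ ξ < ε + ε, 𝓕 (⇑F) ξ = 0 := fun ξ hξ => by
    rw [hFv]
    exact fourier_mul_fourierInv_eq_zero v.integrable hU
      (fun ξ hξ => by rw [hvu, hu ξ hξ, map_zero]) hu hξ
  have hFi : Integrable (𝓕 ⇑F) := (𝓕 F).integrable
  have hFm : Measurable (𝓕 ⇑F) := (𝓕 F).continuous.measurable
  refine ⟨fun ξ => -(δ : ℂ) * ((2 * π * Complex.I * ξ)⁻¹ * 𝓕 (⇑F) ξ),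
    (integrable_inv_mul_of_eq_zero hFi (add_pos hε hε) hF0).const_mul _, by fun_prop,
    fun ξ hξ => by simp [hF0 ξ (by linarith)], ?_, ?_⟩
  · ext x
    rw [fourierInv_const_mul, gaugeT, ← funext hF,
      pinv_eq_fourierInv F.integrable F.continuous hFi (add_pos hε hε) hF0]
  · have h := lintegral_weight_div_fourier_mul_fourierInv_le hw hw0 hK0 hK v.integrable hU
      (𝓕 u).continuous.measurable (fun ξ => by rw [hvu]; simp)
      (fun ξ hξ => hu ξ (by linarith)) (fun ξ hξ => by rw [← hFv]; exact hF0 ξ (by linarith))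
    rw [← hFv] at h
    have hwm := hw.measurable
    calc _ = ∫⁻ η, ENNReal.ofReal |δ| *
          ‖(w η : ℂ) * ((2 * π * Complex.I * η)⁻¹ * 𝓕 (⇑F) η)‖ₑ := by
          congr 1; ext η
          rw [mul_left_comm, enorm_mul, enorm_neg, ← ofReal_norm (δ : ℂ), Complex.norm_real,
            Real.norm_eq_abs]
      _ = ENNReal.ofReal |δ| *
          ∫⁻ η, ‖(w η : ℂ) * ((2 * π * Complex.I * η)⁻¹ * 𝓕 (⇑F) η)‖ₑ :=
          lintegral_const_mul _ (by fun_prop)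
      _ ≤ _ := by
          rw [mul_div_assoc, ENNReal.ofReal_mul (abs_nonneg δ),
            mul_assoc (ENNReal.ofReal |δ|)]
          exact mul_le_mul' le_rfl h

/-- Boundedness of the gauge transform in `E^s_σ`: for `σ > 0`, `ε₀ > 0`, `δ ∈ ℝ`, there is
`C > 0` such that for all `s ≤ 0` and all Schwartz `u` with `supp 𝓕u ⊆ [ε₀, ∞)`,
`‖𝒢(u)‖_{E^s_σ} ≤ exp(C ‖u‖²_{E^s_σ}) ‖u‖_{E^s_σ}`. -/
theorem stmt_10 (σ ε₀ δ : ℝ) (hσ : 0 < σ) (hε : 0 < ε₀) :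
    ∃ C > 0, ∀ s ≤ (0 : ℝ), ∀ u : SchwartzMap ℝ ℂ,
      Function.support (𝓕 ⇑u) ⊆ Set.Ici ε₀ →
      Enorm s σ (gaugeT δ ⇑u) ≤ Real.exp (C * Enorm s σ ⇑u ^ 2) * Enorm s σ ⇑u := by
  set K : ℝ := 2 ^ (σ / 2)
  have hK0 : 0 < K := by positivity
  refine ⟨K * (|δ| * K / 2) + 1, by positivity, fun s hs u hsupp => ?_⟩
  have hu : ∀ ξ < ε₀, 𝓕 (⇑u) ξ = 0 := fun ξ hξ => by
    by_contra h
    exact absurd (hsupp h) (not_le.2 hξ)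
  have hu0 : ∀ ξ < 0, 𝓕 (⇑u) ξ = 0 := fun ξ hξ => hu ξ (hξ.trans hε)
  set w : ℝ → ℝ := fun ξ => (1 + ξ ^ 2) ^ (σ / 2) * (2 : ℝ) ^ (s * ξ)
  have hw : Continuous w := by
    refine Continuous.mul (Continuous.rpow_const (by fun_prop) fun ξ => Or.inl (by positivity)) ?_
    exact Continuous.rpow (by fun_prop) (by fun_prop) fun ξ => Or.inl two_ne_zero
  have hw0 (ξ : ℝ) : 0 ≤ w ξ := by positivity
  have hwK : ∀ x y, w (x + y) ≤ K * w x * w y := weight_add_le hσ.le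
  obtain ⟨G, hG, hGm, hG0, hgauge, hGw⟩ :=
    exists_gaugeT_eq_mul_exp_fourierInv hw hw0 hK0.le hwK hε δ u hu
  have hfin : eLpNorm (fun ξ => (w ξ : ℂ) * 𝓕 (⇑u) ξ) 2 < ⊤ :=
    eLpNorm_weight_mul_schwartz_lt_top hs (𝓕 u) hu0
  have hE := Enorm_eq_toReal_eLpNorm (s := s) (σ := σ) (𝓕 u).continuous.measurable hu0
  set N := eLpNorm (fun ξ => (w ξ : ℂ) * 𝓕 (⇑u) ξ) 2 with hN
  have hNE : N = ENNReal.ofReal (Enorm s σ ⇑u) := by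
    rw [hE]; exact (ENNReal.ofReal_toReal hfin.ne).symm
  have hE0 : 0 ≤ Enorm s σ ⇑u := by rw [hE]; exact ENNReal.toReal_nonneg
  have hB : ∫⁻ η, ‖(w η : ℂ) * G η‖ₑ ≤ ENNReal.ofReal (|δ| * K / 2 * Enorm s σ ⇑u ^ 2) := by
    rwa [ENNReal.ofReal_mul (by positivity), ENNReal.ofReal_pow hE0, ← hNE]
  have hmain := eLpNorm_weight_fourier_mul_exp_le hw hw0 hK0.le hwK u.integrable hG hGm
    (by positivity) hB
  have hint : Integrable fun x => u x * Complex.exp (𝓕⁻ G x) := by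
    refine u.integrable.mul_bdd (c := Real.exp (∫ ξ, ‖G ξ‖))
      (continuous_fourierInv_of_integrable hG).cexp.aestronglyMeasurable
      (Eventually.of_forall fun x => ?_)
    rw [Complex.norm_exp]
    exact Real.exp_le_exp.2 ((Complex.re_le_norm _).trans (norm_fourierInv_le x))
  rw [← hgauge] at hmain hint
  have hgE := Enorm_eq_toReal_eLpNorm (s := s) (σ := σ) (f := gaugeT δ ⇑u)
    (continuous_fourier_of_integrable hint).measurable fun ξ hξ => by
      rw [hgauge]; exact fourier_mul_exp_fourierInv_eq_zero u.integrable hG hu0 hG0 hξ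
  rw [← hN, hNE, ← ENNReal.ofReal_mul (Real.exp_pos _).le] at hmain
  rw [hgE]
  refine (ENNReal.toReal_le_of_le_ofReal (by positivity) hmain).trans ?_
  refine mul_le_mul_of_nonneg_right (Real.exp_le_exp.2 ?_) hE0
  nlinarith [sq_nonneg (Enorm s σ ⇑u)]
end

section
/- Let α ∈ ℝ and let u : ℝ → 𝒮(ℝ;ℂ) be a continuously differentiable curve in the Schwartz space, written u(t,x), which solves the nonlocal NLS: for all (t,x), i∂ₜu(t,x) + ∂ₓ²u(t,x) + α u(t,x)² conj(u(t,−x)) = 0. Then the mass M(t) := ∫_ℝ u(t,x) · conj(u(t,−x)) dx is constant in t: M(t) = M(0) for all t. -/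
open MeasureTheory

namespace SchwartzMap

/-- The operation `f ↦ f*`, where `f* x = conj (f (-x))`, on Schwartz functions. -/
noncomputable def conjReflect : SchwartzMap ℝ ℂ →L[ℝ] SchwartzMap ℝ ℂ :=
  (postcompCLM (Complex.conjCLE : ℂ →L[ℝ] ℂ)).comp
    (compCLMOfContinuousLinearEquiv ℝ (ContinuousLinearEquiv.neg ℝ))

lemma conjReflect_apply (f : SchwartzMap ℝ ℂ) (x : ℝ) :
    conjReflect f x = (starRingEnd ℂ) (f (-x)) :=
  rfl

lemma derivCLM_conjReflect (f : SchwartzMap ℝ ℂ) :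
    derivCLM ℝ ℂ (conjReflect f) = -conjReflect (derivCLM ℝ ℂ f) := by
  ext x
  have h : HasDerivAt (fun y => f (-y)) (-(deriv f (-x))) x := by
    simpa [Function.comp_def] using (f.hasDerivAt (-x)).scomp x (hasDerivAt_neg x)
  have h' : HasDerivAt (conjReflect f) (star (-(deriv f (-x)))) x := h.star
  rw [derivCLM_apply, h'.deriv, neg_apply, conjReflect_apply, derivCLM_apply, star_neg]
  rfl

lemma derivCLM_derivCLM_conjReflect (f : SchwartzMap ℝ ℂ) :
    derivCLM ℝ ℂ (derivCLM ℝ ℂ (conjReflect f)) =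
      conjReflect (derivCLM ℝ ℂ (derivCLM ℝ ℂ f)) := by
  rw [derivCLM_conjReflect, map_neg, derivCLM_conjReflect, neg_neg]

lemma integrable_mul (f g : SchwartzMap ℝ ℂ) : Integrable fun x => f x * g x :=
  (pairing (ContinuousLinearMap.mul ℝ ℂ) f g).integrable

/-- Green's formula for Schwartz functions on the line. -/
lemma integral_mul_derivCLM_derivCLM (f g : SchwartzMap ℝ ℂ) :
    ∫ x, f x * derivCLM ℝ ℂ (derivCLM ℝ ℂ g) x =
      ∫ x, derivCLM ℝ ℂ (derivCLM ℝ ℂ f) x * g x := by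
  have h₁ := integral_mul_deriv_eq_neg_deriv_mul f (derivCLM ℝ ℂ g)
  have h₂ := integral_mul_deriv_eq_neg_deriv_mul (derivCLM ℝ ℂ f) g
  simp only [← derivCLM_apply ℝ] at h₁ h₂
  rw [h₁, h₂, neg_neg]

/-- A continuous curve of Schwartz functions decays quadratically, uniformly on compact sets. -/
lemma exists_norm_le_mul_inv_one_add_sq {u : ℝ → SchwartzMap ℝ ℂ} (hu : Continuous u)
    {K : Set ℝ} (hK : IsCompact K) :
    ∃ C, 0 ≤ C ∧ ∀ t ∈ K, ∀ x, ‖u t x‖ ≤ C * (1 + x ^ 2)⁻¹ := by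
  have hc (k : ℕ) : Continuous fun t => SchwartzMap.seminorm ℝ k 0 (u t) :=
    ((schwartz_withSeminorms ℝ ℝ ℂ).continuous_seminorm (k, 0)).comp hu
  obtain ⟨C, hC⟩ := hK.exists_bound_of_continuousOn ((hc 0).add (hc 2)).continuousOn
  refine ⟨max C 0, le_max_right _ _, fun t ht x => ?_⟩
  have h0 := norm_le_seminorm ℝ (u t) x
  have h2 := norm_pow_mul_le_seminorm ℝ (u t) 2 x
  have h := (le_abs_self _).trans ((hC t ht).trans (le_max_left C 0))
  rw [Real.norm_eq_abs, sq_abs] at h2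
  rw [← div_eq_mul_inv, le_div_iff₀ (by positivity)]
  rw [Pi.add_apply] at h
  linarith

/-- Differentiation under the integral sign for a product of two `C¹` curves of Schwartz
functions. -/
lemma hasDerivAt_integral_mul {u ut v vt : ℝ → SchwartzMap ℝ ℂ}
    (hu : Continuous u) (hut : Continuous ut) (hv : Continuous v) (hvt : Continuous vt)
    (hdu : ∀ t x, HasDerivAt (fun τ => u τ x) (ut t x) t)
    (hdv : ∀ t x, HasDerivAt (fun τ => v τ x) (vt t x) t) (t : ℝ) :
    HasDerivAt (fun τ => ∫ x, u τ x * v τ x) (∫ x, (ut t x * v t x + u t x * vt t x)) t := by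
  have hK : IsCompact (Metric.closedBall t 1) := isCompact_closedBall t 1
  obtain ⟨A, hA0, hA⟩ := exists_norm_le_mul_inv_one_add_sq hu hK
  obtain ⟨A', hA0', hA'⟩ := exists_norm_le_mul_inv_one_add_sq hut hK
  obtain ⟨B, hB0, hB⟩ := exists_norm_le_mul_inv_one_add_sq hv hK
  obtain ⟨B', hB0', hB'⟩ := exists_norm_le_mul_inv_one_add_sq hvt hK
  refine (hasDerivAt_integral_of_dominated_loc_of_deriv_le
    (bound := fun x => (A' * B + A * B') * (1 + x ^ 2)⁻¹)
    (F' := fun τ x => ut τ x * v τ x + u τ x * vt τ x)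
    (Metric.closedBall_mem_nhds t one_pos)
    (.of_forall fun τ => (integrable_mul (u τ) (v τ)).aestronglyMeasurable)
    (integrable_mul (u t) (v t))
    ((integrable_mul (ut t) (v t)).add (integrable_mul (u t) (vt t))).aestronglyMeasurable
    (.of_forall fun x τ hτ => ?_) (integrable_inv_one_add_sq.const_mul _)
    (.of_forall fun x τ _ => (hdu τ x).mul (hdv τ x))).2
  have hx : (1 + x ^ 2)⁻¹ ≤ 1 := inv_le_one_of_one_le₀ (by nlinarith [sq_nonneg x])
  calc ‖ut τ x * v τ x + u τ x * vt τ x‖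
      ≤ ‖ut τ x‖ * ‖v τ x‖ + ‖u τ x‖ * ‖vt τ x‖ := by
        simpa only [norm_mul] using norm_add_le (ut τ x * v τ x) (u τ x * vt τ x)
    _ ≤ A' * (1 + x ^ 2)⁻¹ * B + A * (1 + x ^ 2)⁻¹ * B' := by
        gcongr
        · exact hA' τ hτ x
        · exact (hB τ hτ x).trans (mul_le_of_le_one_right hB0 hx)
        · exact hA τ hτ x
        · exact (hB' τ hτ x).trans (mul_le_of_le_one_right hB0' hx)
    _ = (A' * B + A * B') * (1 + x ^ 2)⁻¹ := by ring

end SchwartzMap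

open SchwartzMap

/-- Mass conservation for the nonlocal NLS: if `u(t,·)` is a continuously differentiable curve
of Schwartz functions (with time derivative `ut`) solving `i uₜ + ∂ₓ²u + α u² u* = 0`, where
`u*(t,x) = conj(u(t,−x))`, then `M(t) = ∫ u(t,x) conj(u(t,−x)) dx` is constant. -/
theorem stmt_17 (α : ℝ) (u ut : ℝ → SchwartzMap ℝ ℂ)
    (hu : Continuous u) (hut : Continuous ut)
    (hderiv : ∀ t x : ℝ, HasDerivAt (fun τ => u τ x) (ut t x) t)
    (heq : ∀ t x : ℝ,
      Complex.I * ut t x + deriv (deriv (fun y => u t y)) x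
        + (α : ℂ) * (u t x) ^ 2 * (starRingEnd ℂ) (u t (-x)) = 0) :
    ∀ t : ℝ,
      (∫ x : ℝ, u t x * (starRingEnd ℂ) (u t (-x)))
        = ∫ x : ℝ, u 0 x * (starRingEnd ℂ) (u 0 (-x)) := by
  have hdv (t x : ℝ) :
      HasDerivAt (fun τ => conjReflect (u τ) x) (conjReflect (ut t) x) t :=
    (hderiv t (-x)).star
  have hpde (t x : ℝ) :
      Complex.I * ut t x + derivCLM ℝ ℂ (derivCLM ℝ ℂ (u t)) x
        + α * u t x ^ 2 * conjReflect (u t) x = 0 :=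
    heq t x
  have hpde_conj (t x : ℝ) :
      -Complex.I * conjReflect (ut t) x
        + derivCLM ℝ ℂ (derivCLM ℝ ℂ (conjReflect (u t))) x
        + α * conjReflect (u t) x ^ 2 * u t x = 0 := by
    rw [derivCLM_derivCLM_conjReflect]
    simpa [conjReflect_apply] using congrArg (starRingEnd ℂ) (hpde t (-x))
  have hM (t : ℝ) : HasDerivAt (fun τ => ∫ x, u τ x * conjReflect (u τ) x) 0 t := by
    convert hasDerivAt_integral_mul (v := fun τ => conjReflect (u τ))
      (vt := fun τ => conjReflect (ut τ)) hu hut (conjReflect.continuous.comp hu)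
      (conjReflect.continuous.comp hut) hderiv hdv t using 1
    have hint (x : ℝ) : ut t x * conjReflect (u t) x + u t x * conjReflect (ut t) x =
        Complex.I * (derivCLM ℝ ℂ (derivCLM ℝ ℂ (u t)) x * conjReflect (u t) x
          - u t x * derivCLM ℝ ℂ (derivCLM ℝ ℂ (conjReflect (u t))) x) := by
      linear_combination -Complex.I * conjReflect (u t) x * hpde t x
        + Complex.I * u t x * hpde_conj t x
        + (ut t x * conjReflect (u t) x + u t x * conjReflect (ut t) x) * Complex.I_sq
    simp only [hint]
    rw [integral_const_mul, integral_sub (integrable_mul _ _) (integrable_mul _ _),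
      integral_mul_derivCLM_derivCLM, sub_self, mul_zero]
  exact fun t => is_const_of_deriv_eq_zero (fun s => (hM s).differentiableAt)
    (fun s => (hM s).deriv) t 0
end
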